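/- For π/2 ≤ δ < π, the function B̃_δ(z) = ∫₀^z B_δ(t)/t dt = Σ_{n=1}^∞ (A_n/n) zⁿ, where A_n = (-1)^{n-1} sin(nδ)/(n sin δ), is convex univalent on the unit disc. -/

import Mathlib

open Complex Metric

/-- Dorff's function `B_δ`. -/
noncomputable def Bdelta (δ : ℝ) (z : ℂ) : ℂ :=
  (1 / (2 * Complex.I * Real.sin δ)) *
    Complex.log ((1 + z * Complex.exp (Complex.I * δ)) /
      (1 + z * Complex.exp (-Complex.I * δ)))

/-- `B̃_δ(z) = ∫₀^z B_δ(t)/t dt`, parametrized along the segment. -/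
noncomputable def Btilde (δ : ℝ) (z : ℂ) : ℂ :=
  ∫ t in (0 : ℝ)..1, Bdelta δ ((t : ℂ) * z) / ((t : ℂ) * z) * z

/-- The hypothesis `hray` says that `z ↦ z * F' z` meets each ray from the origin at most once
on each circle centred at the origin; then `F` has a strict tangent support line at `w`. -/
theorem re_div_lt_re_div_of_ray_injective {F F' : ℂ → ℂ}
    (hF : ∀ z ∈ ball (0 : ℂ) 1, HasDerivAt F (F' z) z)
    (hne : ∀ z ∈ ball (0 : ℂ) 1, F' z ≠ 0)
    (hray : ∀ z ∈ ball (0 : ℂ) 1, ∀ w ∈ ball (0 : ℂ) 1, ‖z‖ = ‖w‖ → ∀ c : ℝ, 0 < c →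
      z * F' z = c * (w * F' w) → z = w)
    {w : ℂ} (hw : w ∈ ball (0 : ℂ) 1) (hw0 : w ≠ 0) {z : ℂ} (hz : ‖z‖ ≤ ‖w‖) (hzw : z ≠ w) :
    (F z / (w * F' w)).re < (F w / (w * F' w)).re := by
  have hwF : w * F' w ≠ 0 := mul_ne_zero hw0 (hne w hw)
  have hw1 : ‖w‖ < 1 := mem_ball_zero_iff.1 hw
  have hsub : closedBall (0 : ℂ) ‖w‖ ⊆ ball 0 1 := closedBall_subset_ball hw1
  set u : ℂ → ℝ := fun z => (F z / (w * F' w)).re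
  have hmax : ∀ ζ ∈ closedBall (0 : ℂ) ‖w‖, IsMaxOn u (closedBall 0 ‖w‖) ζ → ζ = w := by
    intro ζ hζ hm
    have hζ1 := hsub hζ
    set a : ℂ := F' ζ / (w * F' w) with ha
    have ha0 : a ≠ 0 := div_ne_zero (hne ζ hζ1) hwF
    have hderiv : HasFDerivAt u
        (reCLM ∘L ((ContinuousLinearMap.toSpanSingleton ℂ a).restrictScalars ℝ)) ζ :=
      reCLM.hasFDerivAt.comp ζ (((hF ζ hζ1).div_const (w * F' w)).hasFDerivAt.restrictScalars ℝ)
    have hle : ∀ y ∈ closedBall (0 : ℂ) ‖w‖, ((y - ζ) * a).re ≤ 0 := by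
      intro y hy
      have := hm.localize.hasFDerivWithinAt_nonpos hderiv.hasFDerivWithinAt
        (sub_mem_posTangentConeAt_of_segment_subset
          ((convex_closedBall (0 : ℂ) ‖w‖).segment_subset hζ hy))
      simpa using this
    have hapos : 0 < ‖a‖ := norm_pos_iff.2 ha0
    have h1 : ‖w‖ * ‖a‖ ≤ (ζ * a).re := by
      have hy : (‖w‖ : ℂ) * (starRingEnd ℂ a / ‖a‖) ∈ closedBall (0 : ℂ) ‖w‖ := by
        simp [hapos.ne']
      have h2 := hle _ hy
      have h3 : (‖w‖ : ℂ) * (starRingEnd ℂ a / ‖a‖) * a = ((‖w‖ * ‖a‖ : ℝ) : ℂ) := by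
        have : starRingEnd ℂ a * a = (‖a‖ : ℂ) ^ 2 := by rw [mul_comm, mul_conj']
        have hna : (‖a‖ : ℂ) ≠ 0 := by exact_mod_cast hapos.ne'
        push_cast
        field_simp
        linear_combination (‖w‖ : ℂ) * this
      rw [sub_mul, sub_re, h3, ofReal_re] at h2
      linarith
    have hζw : ‖ζ‖ ≤ ‖w‖ := mem_closedBall_zero_iff.1 hζ
    have h4 : (ζ * a).re ≤ ‖ζ * a‖ := re_le_norm _
    have h5 : ‖ζ * a‖ = ‖ζ‖ * ‖a‖ := norm_mul _ _
    have h6 : ‖ζ‖ * ‖a‖ ≤ ‖w‖ * ‖a‖ := by gcongr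
    have h7 : ‖ζ‖ = ‖w‖ := by
      have : ‖ζ‖ * ‖a‖ = ‖w‖ * ‖a‖ := by linarith
      exact mul_right_cancel₀ hapos.ne' this
    have h8 : (ζ * a).re = ‖ζ * a‖ := by linarith
    have h9 : ζ * a = ((‖ζ * a‖ : ℝ) : ℂ) := by
      have h10 := re_eq_norm.1 h8
      rw [← h8]
      exact eq_re_of_ofReal_le h10
    refine hray ζ hζ1 w hw h7 ‖ζ * a‖ ?_ ?_
    · rw [h5, h7]; exact mul_pos (norm_pos_iff.2 hw0) hapos
    · rw [← h9, ha]; field_simp [hne w hw]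
  have hcont : ContinuousOn u (closedBall 0 ‖w‖) := fun x hx =>
    (continuous_re.continuousAt.comp
      ((hF x (hsub hx)).continuousAt.div_const (w * F' w))).continuousWithinAt
  obtain ⟨ζ, hζ, hm⟩ := (isCompact_closedBall (0 : ℂ) ‖w‖).exists_isMaxOn
    (nonempty_closedBall.2 (norm_nonneg w)) hcont
  have hζw := hmax ζ hζ hm
  subst hζw
  by_contra! hlt
  exact hzw (hmax z (mem_closedBall_zero_iff.2 hz) fun y hy => (hm hy).trans hlt)

/-- Alexander's criterion in the form: if `z ↦ z * F' z` is starlike then `F` is convex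
univalent. -/
theorem injOn_and_convex_image_of_ray_injective {F F' : ℂ → ℂ}
    (hF : ∀ z ∈ ball (0 : ℂ) 1, HasDerivAt F (F' z) z)
    (hne : ∀ z ∈ ball (0 : ℂ) 1, F' z ≠ 0)
    (hray : ∀ z ∈ ball (0 : ℂ) 1, ∀ w ∈ ball (0 : ℂ) 1, ‖z‖ = ‖w‖ → ∀ c : ℝ, 0 < c →
      z * F' z = c * (w * F' w) → z = w) :
    Set.InjOn F (ball 0 1) ∧ Convex ℝ (F '' ball 0 1) := by
  have hsupp := @re_div_lt_re_div_of_ray_injective F F' hF hne hray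
  constructor
  · intro z hz w hw h
    by_contra hzw
    wlog hle : ‖z‖ ≤ ‖w‖ generalizing z w
    · exact this hw hz h.symm (Ne.symm hzw) (le_of_not_ge hle)
    have hw0 : w ≠ 0 := by
      rintro rfl
      exact hzw (by simpa using hle)
    exact (hsupp hw hw0 hle hzw).ne (by rw [h])
  · rw [convex_iff_segment_subset]
    rintro _ ⟨p, hp, rfl⟩ _ ⟨q, hq, rfl⟩ m hm
    by_contra hmF
    rw [mem_ball_zero_iff] at hp hq
    obtain ⟨r, hr, hr1⟩ := exists_between (max_lt hp hq)
    obtain ⟨hpr, hqr⟩ := max_lt_iff.1 hr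
    have hr0 : 0 < r := (norm_nonneg p).trans_lt hpr
    set U := F '' ball 0 r
    have hcl : closedBall (0 : ℂ) r ⊆ ball 0 1 := closedBall_subset_ball hr1
    have hcontF : ContinuousOn F (closedBall 0 r) := fun x hx =>
      (hF x (hcl hx)).continuousAt.continuousWithinAt
    have hdiff : DifferentiableOn ℂ F (ball 0 1) := fun x hx =>
      (hF x hx).differentiableAt.differentiableWithinAt
    have hUo : IsOpen U := by
      rw [isOpen_iff_mem_nhds]
      rintro _ ⟨x, hx, rfl⟩
      have hx1 := hcl (ball_subset_closedBall hx)
      have hstrict : HasStrictDerivAt F (F' x) x := by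
        have := ((hdiff.analyticAt (isOpen_ball.mem_nhds hx1)).contDiffAt
          (n := 1)).hasStrictDerivAt (by norm_num)
        rwa [(hF x hx1).deriv] at this
      rw [← hstrict.map_nhds_eq (hne x hx1)]
      exact Filter.image_mem_map (isOpen_ball.mem_nhds hx)
    have hmU : m ∉ U := fun h => hmF (Set.image_mono (ball_subset_ball hr1.le) h)
    obtain ⟨b, ⟨hbU, hb⟩, hbU'⟩ : ∃ b ∈ closure U ∩ segment ℝ (F p) (F q), b ∉ U := by
      by_contra! h
      exact hmU ((convex_segment (F p) (F q)).isPreconnected.subset_of_closure_inter_subset hUo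
        ⟨F p, left_mem_segment ℝ _ _, p, mem_ball_zero_iff.2 hpr, rfl⟩ h hm)
    have hbcl : b ∈ F '' closedBall 0 r :=
      closure_minimal (Set.image_mono ball_subset_closedBall)
        ((isCompact_closedBall (0 : ℂ) r).image_of_continuousOn hcontF).isClosed hbU
    obtain ⟨w, hw, rfl⟩ := hbcl
    have hwr : ‖w‖ = r := by
      refine le_antisymm (mem_closedBall_zero_iff.1 hw) (not_lt.1 fun h => hbU' ?_)
      exact ⟨w, mem_ball_zero_iff.2 h, rfl⟩
    have hw0 : w ≠ 0 := by
      rw [← norm_pos_iff, hwr]; exact hr0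
    have hp' := hsupp (hcl hw) hw0 (z := p) (by rw [hwr]; exact hpr.le)
      (by rintro rfl; exact hpr.ne hwr)
    have hq' := hsupp (hcl hw) hw0 (z := q) (by rw [hwr]; exact hqr.le)
      (by rintro rfl; exact hqr.ne hwr)
    have hconv : Convex ℝ {x : ℂ | (x / (w * F' w)).re < (F w / (w * F' w)).re} := by
      refine convex_halfSpace_lt (f := fun x : ℂ => (x / (w * F' w)).re) ?_ _
      constructor
      · intro x y; simp [add_div]
      · intro c x; simp [mul_div_assoc]
    exact lt_irrefl (F w / (w * F' w)).re (hconv.segment_subset hp' hq' hb)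

/-- The logarithm in the definition of `Bdelta`, split into a difference. -/
noncomputable def logQuot (δ : ℝ) (z : ℂ) : ℂ :=
  log (1 + z * exp (I * δ)) - log (1 + z * exp (-I * δ))

/-- The inverse of `logQuot δ`, defined on the strip `δ - π < im ℓ < δ`. -/
noncomputable def logQuotInv (δ : ℝ) (ℓ : ℂ) : ℂ :=
  (exp ℓ - 1) / (exp (I * δ) - exp ℓ * exp (-I * δ))

theorem norm_exp_I_mul_real (δ : ℝ) : ‖exp (I * δ)‖ = 1 := by
  rw [mul_comm]; exact norm_exp_ofReal_mul_I δ

theorem norm_exp_neg_I_mul_real (δ : ℝ) : ‖exp (-I * δ)‖ = 1 := by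
  have := norm_exp_I_mul_real (-δ)
  rwa [ofReal_neg, mul_neg, ← neg_mul] at this

theorem exp_I_sub_exp_neg_I (δ : ℝ) : exp (I * δ) - exp (-I * δ) = 2 * I * Real.sin δ := by
  have h1 : exp (I * δ) = cos δ + sin δ * I := by rw [mul_comm, exp_mul_I]
  have h2 : exp (-I * δ) = cos δ - sin δ * I := by
    rw [neg_mul, ← mul_neg, mul_comm, exp_mul_I, cos_neg, sin_neg]; ring
  rw [h1, h2, ofReal_sin]; ring

theorem norm_sq_sub_norm_sq_exp (δ : ℝ) (ℓ : ℂ) :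
    ‖exp (I * δ) - exp ℓ * exp (-I * δ)‖ ^ 2 - ‖exp ℓ - 1‖ ^ 2 =
      4 * Real.exp ℓ.re * Real.sin δ * Real.sin (δ - ℓ.im) := by
  simp only [← normSq_eq_norm_sq, normSq_apply, sub_re, sub_im, mul_re, mul_im, exp_re, exp_im,
    one_re, one_im, I_re, I_im, neg_re, neg_im, ofReal_re, ofReal_im, Real.sin_sub]
  simp only [mul_zero, zero_mul, neg_zero, sub_zero, zero_add, one_mul, neg_one_mul,
    sub_self, Real.exp_zero, Real.cos_neg, Real.sin_neg]
  have h1 := Real.sin_sq_add_cos_sq δ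
  set s := Real.sin δ
  set c := Real.cos δ
  set a := Real.sin ℓ.im
  set b := Real.cos ℓ.im
  set X := Real.exp ℓ.re
  linear_combination (1 + X ^ 2 * (a ^ 2 + b ^ 2) - 2 * X * b) * h1

theorem one_add_mul_mem_slitPlane {z u : ℂ} (hz : z ∈ ball (0 : ℂ) 1) (hu : ‖u‖ = 1) :
    1 + z * u ∈ slitPlane := by
  apply mem_slitPlane_of_norm_lt_one
  simpa [hu] using hz

theorem abs_arg_one_add_mul_lt {z u : ℂ} (hz : z ∈ ball (0 : ℂ) 1) (hu : ‖u‖ = 1) :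
    |arg (1 + z * u)| < Real.pi / 2 := by
  rw [abs_arg_lt_pi_div_two_iff]
  left
  have h : ‖z * u‖ < 1 := by simpa [hu] using hz
  have := abs_le.1 (abs_re_le_norm (z * u))
  simp only [add_re, one_re]
  linarith [this.1]

section

variable {δ : ℝ}

theorem abs_im_logQuot_lt {z : ℂ} (hz : z ∈ ball (0 : ℂ) 1) : |(logQuot δ z).im| < Real.pi := by
  have h1 := abs_lt.1 (abs_arg_one_add_mul_lt hz (norm_exp_I_mul_real δ))
  have h2 := abs_lt.1 (abs_arg_one_add_mul_lt hz (norm_exp_neg_I_mul_real δ))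
  rw [logQuot, sub_im, log_im, log_im, abs_lt]
  constructor <;> linarith [h1.1, h1.2, h2.1, h2.2]

theorem exp_logQuot {z : ℂ} (hz : z ∈ ball (0 : ℂ) 1) :
    exp (logQuot δ z) = (1 + z * exp (I * δ)) / (1 + z * exp (-I * δ)) := by
  rw [logQuot, exp_sub,
    exp_log (slitPlane_ne_zero (one_add_mul_mem_slitPlane hz (norm_exp_I_mul_real δ))),
    exp_log (slitPlane_ne_zero (one_add_mul_mem_slitPlane hz (norm_exp_neg_I_mul_real δ)))]

theorem Bdelta_eq_logQuot {z : ℂ} (hz : z ∈ ball (0 : ℂ) 1) :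
    Bdelta δ z = 1 / (2 * I * Real.sin δ) * logQuot δ z := by
  have h := abs_lt.1 (abs_im_logQuot_lt (δ := δ) hz)
  rw [Bdelta, ← exp_logQuot hz, log_exp h.1 h.2.le]

theorem hasDerivAt_logQuot {z : ℂ} (hz : z ∈ ball (0 : ℂ) 1) :
    HasDerivAt (logQuot δ)
      (exp (I * δ) / (1 + z * exp (I * δ)) - exp (-I * δ) / (1 + z * exp (-I * δ))) z := by
  refine HasDerivAt.sub ?_ ?_
  · refine HasDerivAt.clog ?_ (one_add_mul_mem_slitPlane hz (norm_exp_I_mul_real δ))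
    simpa using ((hasDerivAt_id z).mul_const (exp (I * δ))).const_add 1
  · refine HasDerivAt.clog ?_ (one_add_mul_mem_slitPlane hz (norm_exp_neg_I_mul_real δ))
    simpa using ((hasDerivAt_id z).mul_const (exp (-I * δ))).const_add 1

theorem logQuot_zero : logQuot δ 0 = 0 := by simp [logQuot]

theorem logQuotInv_zero : logQuotInv δ 0 = 0 := by simp [logQuotInv]

theorem two_I_mul_sin_ne_zero (hs : 0 < Real.sin δ) : 2 * I * (Real.sin δ : ℂ) ≠ 0 := by
  have : (Real.sin δ : ℂ) ≠ 0 := by exact_mod_cast hs.ne'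
  simpa using this

theorem exp_I_sub_exp_neg_I_ne_zero (hs : 0 < Real.sin δ) :
    exp (I * δ) - exp (-I * δ) ≠ 0 := by
  rw [exp_I_sub_exp_neg_I]
  exact two_I_mul_sin_ne_zero hs

theorem exp_I_sub_exp_logQuot_mul {z : ℂ} (hz : z ∈ ball (0 : ℂ) 1) :
    exp (I * δ) - exp (logQuot δ z) * exp (-I * δ) =
      (exp (I * δ) - exp (-I * δ)) / (1 + z * exp (-I * δ)) := by
  have h := slitPlane_ne_zero (one_add_mul_mem_slitPlane hz (norm_exp_neg_I_mul_real δ))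
  rw [exp_logQuot hz]
  generalize exp (-I * δ) = v at *
  field_simp
  ring

theorem exp_I_sub_exp_logQuot_mul_ne_zero (hs : 0 < Real.sin δ) {z : ℂ}
    (hz : z ∈ ball (0 : ℂ) 1) : exp (I * δ) - exp (logQuot δ z) * exp (-I * δ) ≠ 0 := by
  rw [exp_I_sub_exp_logQuot_mul hz]
  exact div_ne_zero (exp_I_sub_exp_neg_I_ne_zero hs)
    (slitPlane_ne_zero (one_add_mul_mem_slitPlane hz (norm_exp_neg_I_mul_real δ)))

theorem logQuotInv_logQuot (hs : 0 < Real.sin δ) {z : ℂ} (hz : z ∈ ball (0 : ℂ) 1) :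
    logQuotInv δ (logQuot δ z) = z := by
  rw [logQuotInv, div_eq_iff (exp_I_sub_exp_logQuot_mul_ne_zero hs hz),
    exp_I_sub_exp_logQuot_mul hz, exp_logQuot hz]
  have h := slitPlane_ne_zero (one_add_mul_mem_slitPlane hz (norm_exp_neg_I_mul_real δ))
  generalize exp (-I * δ) = v at *
  field_simp
  ring

theorem norm_exp_sub_one_lt (hs : 0 < Real.sin δ) {ℓ : ℂ} (h1 : δ - Real.pi < ℓ.im)
    (h2 : ℓ.im < δ) : ‖exp ℓ - 1‖ < ‖exp (I * δ) - exp ℓ * exp (-I * δ)‖ := by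
  have h := norm_sq_sub_norm_sq_exp δ ℓ
  have hsin : 0 < Real.sin (δ - ℓ.im) :=
    Real.sin_pos_of_pos_of_lt_pi (by linarith) (by linarith)
  have : 0 < 4 * Real.exp ℓ.re * Real.sin δ * Real.sin (δ - ℓ.im) := by positivity
  exact lt_of_pow_lt_pow_left₀ 2 (norm_nonneg _) (by linarith)

theorem im_logQuot_mem_Ioo (h0 : 0 < δ) (hπ : δ < Real.pi) {z : ℂ} (hz : z ∈ ball (0 : ℂ) 1) :
    (logQuot δ z).im ∈ Set.Ioo (δ - Real.pi) δ := by
  have hs := Real.sin_pos_of_pos_of_lt_pi h0 hπ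
  have hb := abs_lt.1 (abs_im_logQuot_lt (δ := δ) hz)
  have h := norm_sq_sub_norm_sq_exp δ (logQuot δ z)
  have hinv := logQuotInv_logQuot hs hz
  have hden := exp_I_sub_exp_logQuot_mul_ne_zero hs hz
  have hlt : ‖exp (logQuot δ z) - 1‖ <
      ‖exp (I * δ) - exp (logQuot δ z) * exp (-I * δ)‖ := by
    rw [mem_ball_zero_iff, ← hinv, logQuotInv, norm_div, div_lt_one (norm_pos_iff.2 hden)] at hz
    exact hz
  have hpos : 0 < 4 * Real.exp (logQuot δ z).re * Real.sin δ * Real.sin (δ - (logQuot δ z).im) := by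
    rw [← h, sub_pos]
    gcongr
  have hsin : 0 < Real.sin (δ - (logQuot δ z).im) := by
    exact pos_of_mul_pos_right hpos (by positivity)
  constructor
  · by_contra! hle
    have := Real.sin_nonpos_of_nonpos_of_neg_pi_le (x := δ - (logQuot δ z).im - 2 * Real.pi)
      (by linarith [hb.1]) (by linarith)
    rw [Real.sin_sub_two_pi] at this
    linarith
  · by_contra! hle
    have := Real.sin_nonpos_of_nonpos_of_neg_pi_le (x := δ - (logQuot δ z).im)
      (by linarith) (by linarith [hb.2])
    linarith

theorem eq_zero_of_logQuot_eq_zero (hs : 0 < Real.sin δ) {z : ℂ} (hz : z ∈ ball (0 : ℂ) 1)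
    (h : logQuot δ z = 0) : z = 0 := by
  rw [← logQuotInv_logQuot hs hz, h, logQuotInv_zero]

/-- Strict Schwarz lemma for `z ↦ logQuotInv δ (c * logQuot δ z)`: the map `logQuot δ` is
starlike. -/
theorem norm_logQuotInv_mul_logQuot_lt (h0 : 0 < δ) (hπ : δ < Real.pi) {c : ℝ} (hc0 : 0 < c)
    (hc1 : c < 1) {z : ℂ} (hz : z ∈ ball (0 : ℂ) 1) (hz0 : z ≠ 0) :
    ‖logQuotInv δ (c * logQuot δ z)‖ < ‖z‖ := by
  have hs := Real.sin_pos_of_pos_of_lt_pi h0 hπ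
  have hlt : ∀ z ∈ ball (0 : ℂ) 1, ‖exp (c * logQuot δ z) - 1‖ <
      ‖exp (I * δ) - exp (c * logQuot δ z) * exp (-I * δ)‖ := by
    intro z hz
    have him := im_logQuot_mem_Ioo h0 hπ hz
    apply norm_exp_sub_one_lt hs <;> rw [im_ofReal_mul]
    · nlinarith [him.1]
    · nlinarith [him.2]
  have hden : ∀ z ∈ ball (0 : ℂ) 1,
      exp (I * δ) - exp (c * logQuot δ z) * exp (-I * δ) ≠ 0 := fun z hz =>
    norm_pos_iff.1 ((norm_nonneg _).trans_lt (hlt z hz))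
  set φ : ℂ → ℂ := fun z => logQuotInv δ (c * logQuot δ z) with hφ
  have hφ0 : φ 0 = 0 := by simp [hφ, logQuot_zero, logQuotInv_zero]
  have hexp : ∀ z ∈ ball (0 : ℂ) 1, HasDerivAt (fun z => exp (c * logQuot δ z))
      (exp (c * logQuot δ z) * (c * (exp (I * δ) / (1 + z * exp (I * δ)) -
        exp (-I * δ) / (1 + z * exp (-I * δ))))) z := fun z hz =>
    ((hasDerivAt_logQuot hz).const_mul (c : ℂ)).cexp
  have hderiv : ∀ z ∈ ball (0 : ℂ) 1, HasDerivAt φ _ z := fun z hz =>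
    ((hexp z hz).sub_const 1).div (((hexp z hz).mul_const (exp (-I * δ))).const_sub (exp (I * δ)))
      (hden z hz)
  have h3 := exp_I_sub_exp_neg_I_ne_zero hs
  have hderiv0 : deriv φ 0 = c := by
    rw [(hderiv 0 (mem_ball_self one_pos)).deriv]
    simp only [logQuot_zero, mul_zero, exp_zero, zero_mul, add_zero, div_one, one_mul, sub_self,
      sub_zero]
    generalize exp (-I * δ) = v at *
    field_simp
  have hd : DifferentiableOn ℂ φ (ball 0 1) := fun z hz =>
    (hderiv z hz).differentiableAt.differentiableWithinAt
  have hmaps : Set.MapsTo φ (ball 0 1) (closedBall (φ 0) 1) := by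
    intro z hz
    rw [hφ0, mem_closedBall_zero_iff]
    simp only [hφ, logQuotInv, norm_div]
    exact (div_le_one (norm_pos_iff.2 (hden z hz))).2 (hlt z hz).le
  refine lt_of_le_of_ne (norm_le_norm_of_mapsTo_ball hd (by rwa [hφ0] at hmaps) hφ0
    (mem_ball_zero_iff.1 hz)) fun heq => ?_
  have hslope : ‖dslope φ 0 z‖ = 1 / 1 := by
    rw [dslope_of_ne _ hz0, slope_def_field, hφ0, sub_zero, sub_zero, norm_div, div_one]
    exact (div_eq_one_iff_eq (norm_ne_zero_iff.2 hz0)).2 heq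
  obtain ⟨C, hC, hEq⟩ :=
    affine_of_mapsTo_ball_of_exists_norm_dslope_eq_div' hd hmaps ⟨z, hz, hslope⟩
  have hderivC : deriv φ 0 = C := by
    rw [(hEq.eventuallyEq_of_mem (ball_mem_nhds _ one_pos)).deriv_eq]
    simp [hφ0]
  rw [← hderivC, hderiv0, norm_real, Real.norm_of_nonneg hc0.le] at hC
  linarith

theorem eq_of_logQuot_eq_mul (h0 : 0 < δ) (hπ : δ < Real.pi) {z w : ℂ} (hz : z ∈ ball (0 : ℂ) 1)
    (hw : w ∈ ball (0 : ℂ) 1) (hzw : ‖z‖ = ‖w‖) {c : ℝ} (hc : 0 < c)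
    (h : logQuot δ z = c * logQuot δ w) : z = w := by
  have hs := Real.sin_pos_of_pos_of_lt_pi h0 hπ
  rcases eq_or_ne w 0 with rfl | hw0
  · simpa using hzw
  have hz0 : z ≠ 0 := by rwa [← norm_ne_zero_iff, hzw, norm_ne_zero_iff]
  rcases lt_trichotomy c 1 with hc1 | rfl | hc1
  · have := norm_logQuotInv_mul_logQuot_lt h0 hπ hc hc1 hw hw0
    rw [← h, logQuotInv_logQuot hs hz] at this
    exact absurd hzw this.ne
  · rw [← logQuotInv_logQuot hs hz, h, ofReal_one, one_mul, logQuotInv_logQuot hs hw]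
  · have := norm_logQuotInv_mul_logQuot_lt h0 hπ (inv_pos.2 hc) (inv_lt_one_of_one_lt₀ hc1) hz hz0
    have hc' : (c : ℂ) ≠ 0 := by exact_mod_cast hc.ne'
    rw [h, ofReal_inv, inv_mul_cancel_left₀ hc', logQuotInv_logQuot hs hw] at this
    exact absurd hzw this.ne'

end

section

variable {δ : ℝ}

theorem hasSum_Bdelta (hs : 0 < Real.sin δ) {z : ℂ} (hz : z ∈ ball (0 : ℂ) 1) :
    HasSum (fun n : ℕ =>
      (((-1 : ℝ) ^ n * Real.sin ((n + 1) * δ) / (((n : ℝ) + 1) * Real.sin δ) : ℝ) : ℂ) *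
        z ^ (n + 1)) (Bdelta δ z) := by
  have hu : ‖z * exp (I * δ)‖ < 1 := by
    rw [norm_mul, norm_exp_I_mul_real, mul_one]; exact mem_ball_zero_iff.1 hz
  have hv : ‖z * exp (-I * δ)‖ < 1 := by
    rw [norm_mul, norm_exp_neg_I_mul_real, mul_one]; exact mem_ball_zero_iff.1 hz
  have h := (hasSum_nat_add_iff' 1).2
    (((hasSum_taylorSeries_log hu).sub (hasSum_taylorSeries_log hv)).mul_left
      (1 / (2 * I * (Real.sin δ : ℂ))))
  rw [Bdelta_eq_logQuot hz, logQuot]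
  simp only [Finset.range_one, Finset.sum_singleton, Nat.cast_zero, div_zero, sub_self, mul_zero,
    sub_zero] at h
  refine h.congr_fun fun n => ?_
  have hpow : exp (I * δ) ^ (n + 1) - exp (-I * δ) ^ (n + 1) =
      2 * I * Real.sin ((n + 1) * δ) := by
    have := exp_I_sub_exp_neg_I ((n + 1) * δ)
    rw [← exp_nat_mul, ← exp_nat_mul, ← this]
    push_cast
    ring_nf
  have hs' : (Real.sin δ : ℂ) ≠ 0 := by exact_mod_cast hs.ne'
  have hn : (n : ℂ) + 1 ≠ 0 := by exact_mod_cast n.succ_ne_zero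
  rw [mul_pow, mul_pow, ← sub_div, ← mul_sub, ← mul_sub, hpow]
  push_cast
  generalize (Complex.sin δ) = s at *
  generalize (Complex.sin ((n + 1) * δ)) = t at *
  rw [ofReal_sin] at hs'
  field_simp
  ring

theorem hasSum_Btilde (hs : 0 < Real.sin δ) {z : ℂ} (hz : z ∈ ball (0 : ℂ) 1) :
    HasSum (fun n : ℕ =>
      (((-1 : ℝ) ^ n * Real.sin ((n + 1) * δ) / (((n : ℝ) + 1) ^ 2 * Real.sin δ) : ℝ) : ℂ) *
        z ^ (n + 1)) (Btilde δ z) := by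
  have hz1 : ‖z‖ < 1 := mem_ball_zero_iff.1 hz
  set b : ℕ → ℝ := fun n =>
    (-1 : ℝ) ^ n * Real.sin ((n + 1) * δ) / (((n : ℝ) + 1) * Real.sin δ) with hb
  have hb_le : ∀ n, |b n| ≤ (Real.sin δ)⁻¹ := by
    intro n
    have hn : (0 : ℝ) < n + 1 := by positivity
    rw [hb]
    simp only [abs_div, abs_mul, abs_pow, abs_neg, abs_one, one_pow, one_mul, abs_of_pos hn,
      abs_of_pos hs]
    rw [← one_div]
    gcongr
    · exact Real.abs_sin_le_one _
    · exact le_mul_of_one_le_left hs.le (by linarith [n.cast_nonneg (α := ℝ)])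
  have key := intervalIntegral.hasSum_integral_of_dominated_convergence
    (μ := MeasureTheory.volume) (a := 0) (b := 1)
    (F := fun (n : ℕ) (t : ℝ) => (b n : ℂ) * z ^ (n + 1) * (t : ℂ) ^ n)
    (f := fun t : ℝ => Bdelta δ ((t : ℂ) * z) / ((t : ℂ) * z) * z)
    (fun n _ => (Real.sin δ)⁻¹ * ‖z‖ ^ (n + 1))
    (fun n => Continuous.aestronglyMeasurable (by fun_prop))
    (fun n => Filter.Eventually.of_forall fun t ht => ?_)
    (Filter.Eventually.of_forall fun t _ => ?_) (by simp)
    (Filter.Eventually.of_forall fun t ht => ?_)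
  · refine key.congr_fun fun n => ?_
    have hint : ∫ t in (0 : ℝ)..1, (t : ℂ) ^ n = 1 / (n + 1) := by
      have := integral_pow (a := 0) (b := 1) n
      simp only [← ofReal_pow]
      rw [intervalIntegral.integral_ofReal, this]
      simp
    rw [intervalIntegral.integral_const_mul, hint, hb]
    have hn : (n : ℂ) + 1 ≠ 0 := by exact_mod_cast n.succ_ne_zero
    push_cast
    field_simp
  · rw [Set.uIoc_of_le zero_le_one] at ht
    rw [norm_mul, norm_mul, norm_pow, norm_pow, norm_real, norm_real, Real.norm_eq_abs,
      Real.norm_of_nonneg ht.1.le]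
    calc |b n| * ‖z‖ ^ (n + 1) * t ^ n ≤ (Real.sin δ)⁻¹ * ‖z‖ ^ (n + 1) * 1 := by
          gcongr
          · exact pow_nonneg ht.1.le n
          · exact hb_le n
          · exact pow_le_one₀ ht.1.le ht.2
      _ = _ := mul_one _
  · exact ((summable_nat_add_iff 1).2
      (summable_geometric_of_lt_one (norm_nonneg z) hz1)).mul_left _
  · rw [Set.uIoc_of_le zero_le_one] at ht
    have htz : (t : ℂ) * z ∈ ball (0 : ℂ) 1 := by
      rw [mem_ball_zero_iff, norm_mul, norm_real, Real.norm_of_nonneg ht.1.le]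
      exact (mul_le_of_le_one_left (norm_nonneg z) ht.2).trans_lt hz1
    refine (((hasSum_Bdelta hs htz).div_const ((t : ℂ) * z)).mul_right z).congr_fun fun n => ?_
    have ht0 : (t : ℂ) ≠ 0 := by exact_mod_cast ht.1.ne'
    rcases eq_or_ne z 0 with rfl | hz0
    · simp
    · simp only [hb]
      field_simp
      ring

theorem Bdelta_zero : Bdelta δ 0 = 0 := by simp [Bdelta]

theorem hasDerivAt_Bdelta {z : ℂ} (hz : z ∈ ball (0 : ℂ) 1) :
    HasDerivAt (Bdelta δ) (1 / (2 * I * Real.sin δ) *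
      (exp (I * δ) / (1 + z * exp (I * δ)) - exp (-I * δ) / (1 + z * exp (-I * δ)))) z :=
  ((hasDerivAt_logQuot hz).const_mul _).congr_of_eventuallyEq
    (Filter.eventuallyEq_of_mem (isOpen_ball.mem_nhds hz) fun _ hx => Bdelta_eq_logQuot hx)

theorem mul_dslope_Bdelta (z : ℂ) : z * dslope (Bdelta δ) 0 z = Bdelta δ z := by
  simpa [Bdelta_zero] using sub_smul_dslope (Bdelta δ) 0 z

theorem dslope_Bdelta_ne_zero (hs : 0 < Real.sin δ) {z : ℂ} (hz : z ∈ ball (0 : ℂ) 1) :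
    dslope (Bdelta δ) 0 z ≠ 0 := by
  have hs' := two_I_mul_sin_ne_zero hs
  rcases eq_or_ne z 0 with rfl | hz0
  · rw [dslope_same, (hasDerivAt_Bdelta hz).deriv]
    simp only [zero_mul, add_zero, div_one, exp_I_sub_exp_neg_I]
    exact mul_ne_zero (one_div_ne_zero hs') hs'
  · intro h
    have hB := mul_dslope_Bdelta (δ := δ) z
    rw [h, mul_zero, Bdelta_eq_logQuot hz, eq_comm, mul_eq_zero] at hB
    exact hz0 (eq_zero_of_logQuot_eq_zero hs hz (hB.resolve_left (one_div_ne_zero hs')))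

theorem hasDerivAt_Btilde {z : ℂ} (hz : z ∈ ball (0 : ℂ) 1) :
    HasDerivAt (Btilde δ) (dslope (Bdelta δ) 0 z) z := by
  have hd : DifferentiableOn ℂ (dslope (Bdelta δ) 0) (ball 0 1) :=
    (differentiableOn_dslope (ball_mem_nhds _ one_pos)).2 fun z hz =>
      (hasDerivAt_Bdelta hz).differentiableAt.differentiableWithinAt
  obtain ⟨G, hG0, hG⟩ := hd.isExactOn_ball.with_val_at 0 0
  refine (hG z hz).congr_of_eventuallyEq
    (Filter.eventuallyEq_of_mem (isOpen_ball.mem_nhds hz) fun w hw => ?_)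
  have hmem : ∀ t ∈ Set.uIcc (0 : ℝ) 1, (t : ℂ) * w ∈ ball (0 : ℂ) 1 := by
    intro t ht
    rw [Set.uIcc_of_le zero_le_one] at ht
    rw [mem_ball_zero_iff, norm_mul, norm_real, Real.norm_of_nonneg ht.1]
    exact (mul_le_of_le_one_left (norm_nonneg w) ht.2).trans_lt (mem_ball_zero_iff.1 hw)
  have hint := intervalIntegral.integral_eq_sub_of_hasDerivAt
    (f := fun t : ℝ => G (t * w)) (f' := fun t : ℝ => dslope (Bdelta δ) 0 (t * w) * w)
    (a := 0) (b := 1)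
    (fun t ht => by
      have hlin : HasDerivAt (fun t : ℝ => (t : ℂ) * w) w t := by
        simpa using (ofRealCLM.hasDerivAt (x := t)).mul_const w
      exact (hG _ (hmem t ht)).comp t hlin)
    (ContinuousOn.intervalIntegrable
      ((hd.continuousOn.comp (by fun_prop) hmem).mul continuousOn_const))
  simp only [ofReal_one, one_mul, ofReal_zero, zero_mul, hG0, sub_zero] at hint
  rw [← hint, Btilde]
  refine intervalIntegral.integral_congr_ae (Filter.Eventually.of_forall fun t ht => ?_)
  rw [Set.uIoc_of_le zero_le_one] at ht
  rcases eq_or_ne w 0 with rfl | hw0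
  · simp
  · have htw : (t : ℂ) * w ≠ 0 := mul_ne_zero (by exact_mod_cast ht.1.ne') hw0
    rw [← mul_dslope_Bdelta, mul_div_cancel_left₀ _ htw]

end

/-- `B̃_δ(z) = Σ_{n≥1} (A_n/n) zⁿ` with `A_n = (-1)^{n-1} sin(nδ)/(n sin δ)`, and `B̃_δ` is
convex univalent on the unit disc. -/
theorem Btilde_series_and_convex_univalent (δ : ℝ) (hδ1 : Real.pi / 2 ≤ δ)
    (hδ2 : δ < Real.pi) :
    (∀ z ∈ ball (0 : ℂ) 1,
      HasSum
        (fun n : ℕ =>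
          (((-1 : ℝ) ^ n * Real.sin ((n + 1) * δ) / (((n : ℝ) + 1) ^ 2 * Real.sin δ) : ℝ) : ℂ) *
            z ^ (n + 1))
        (Btilde δ z)) ∧
    Set.InjOn (Btilde δ) (ball 0 1) ∧
    Convex ℝ (Btilde δ '' ball 0 1) := by
  have h0 : 0 < δ := (by positivity : (0 : ℝ) < Real.pi / 2).trans_le hδ1
  have hs := Real.sin_pos_of_pos_of_lt_pi h0 hδ2
  refine ⟨fun z hz => hasSum_Btilde hs hz, injOn_and_convex_image_of_ray_injective
    (fun z hz => hasDerivAt_Btilde hz) (fun z hz => dslope_Bdelta_ne_zero hs hz)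
    fun z hz w hw hzw c hc h => ?_⟩
  rw [mul_dslope_Bdelta, mul_dslope_Bdelta, Bdelta_eq_logQuot hz, Bdelta_eq_logQuot hw,
    mul_left_comm] at h
  exact eq_of_logQuot_eq_mul h0 hδ2 hz hw hzw hc
    (mul_left_cancel₀ (one_div_ne_zero (two_I_mul_sin_ne_zero hs)) h)
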